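/- For every integer n ≥ 1, the following identity holds in the polynomial ring ℤ[p,q,t,u,v,w]: Σ_{σ∈S_n} p^{res σ} q^{les σ} t^{des σ} u^{da* σ} v^{dd* σ} w^{valley* σ} = Σ_{k=0}^{⌊(n−1)/2⌋} a_{n,k}(p,q) · (tw)^k · (u+vt)^{n−1−2k}. -/

import Mathlib

open scoped Classical
open Finset

noncomputable section

namespace SZpaper

/-- `σ` as a 1-indexed function on `[1,n]`, extended by `0` elsewhere
(boundary convention `σ(0)=σ(n+1)=0`). -/
def pext (n : ℕ) (σ : Equiv.Perm (Fin n)) (i : ℕ) : ℕ :=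
  if h : 1 ≤ i ∧ i ≤ n then ((σ ⟨i - 1, by omega⟩ : Fin n) : ℕ) + 1 else 0

/-- `σ` extended with the Brändén boundary convention `σ(0)=σ(n+1)=n+1`. -/
def pextB (n : ℕ) (σ : Equiv.Perm (Fin n)) (i : ℕ) : ℕ :=
  if h : 1 ≤ i ∧ i ≤ n then ((σ ⟨i - 1, by omega⟩ : Fin n) : ℕ) + 1 else n + 1

/-- `σ` extended with the boundary convention `σ(0)=0`, `σ(n+1)=n+1`. -/
def pextC (n : ℕ) (σ : Equiv.Perm (Fin n)) (i : ℕ) : ℕ :=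
  if h : 1 ≤ i ∧ i ≤ n then ((σ ⟨i - 1, by omega⟩ : Fin n) : ℕ) + 1
  else if i = 0 then 0 else n + 1

/-- The set of pairs `(i,j)` with `i, j ∈ [1,n]`. -/
def pairs (n : ℕ) : Finset (ℕ × ℕ) := Finset.Icc 1 n ×ˢ Finset.Icc 1 n

/-- `des σ = #{i ∈ [n−1] : σ(i) > σ(i+1)}`. -/
def desStat (n : ℕ) (σ : Equiv.Perm (Fin n)) : ℕ :=
  ((Finset.Icc 1 (n - 1)).filter fun i => pext n σ (i + 1) < pext n σ i).card

/-- `les σ = #{(i,j) : 2 ≤ i < j ≤ n, σ(i−1) > σ(j) > σ(i)}`. -/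
def lesStat (n : ℕ) (σ : Equiv.Perm (Fin n)) : ℕ :=
  ((pairs n).filter fun x => 2 ≤ x.1 ∧ x.1 < x.2 ∧
    pext n σ x.1 < pext n σ x.2 ∧ pext n σ x.2 < pext n σ (x.1 - 1)).card

/-- `less σ = #{(i,j) : 2 ≤ i < j ≤ n, σ(i−1) < σ(j) < σ(i)}`. -/
def lessStat (n : ℕ) (σ : Equiv.Perm (Fin n)) : ℕ :=
  ((pairs n).filter fun x => 2 ≤ x.1 ∧ x.1 < x.2 ∧
    pext n σ (x.1 - 1) < pext n σ x.2 ∧ pext n σ x.2 < pext n σ x.1).card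

/-- `res σ = #{(i,j) : 1 ≤ i < j ≤ n−1, σ(j+1) > σ(i) > σ(j)}`. -/
def resStat (n : ℕ) (σ : Equiv.Perm (Fin n)) : ℕ :=
  ((pairs n).filter fun x => x.1 < x.2 ∧ x.2 ≤ n - 1 ∧
    pext n σ x.2 < pext n σ x.1 ∧ pext n σ x.1 < pext n σ (x.2 + 1)).card

/-- `ress σ = #{(i,j) : 1 ≤ i < j ≤ n−1, σ(j+1) < σ(i) < σ(j)}`. -/
def ressStat (n : ℕ) (σ : Equiv.Perm (Fin n)) : ℕ :=
  ((pairs n).filter fun x => x.1 < x.2 ∧ x.2 ≤ n - 1 ∧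
    pext n σ (x.2 + 1) < pext n σ x.1 ∧ pext n σ x.1 < pext n σ x.2).card

/-! Linear statistics with the boundary convention `σ(0)=σ(n+1)=0` (starred). -/

def peakStar (n : ℕ) (σ : Equiv.Perm (Fin n)) : ℕ :=
  ((Finset.Icc 1 n).filter fun i =>
    pext n σ (i - 1) < pext n σ i ∧ pext n σ (i + 1) < pext n σ i).card

def valleyStar (n : ℕ) (σ : Equiv.Perm (Fin n)) : ℕ :=
  ((Finset.Icc 1 n).filter fun i =>
    pext n σ i < pext n σ (i - 1) ∧ pext n σ i < pext n σ (i + 1)).card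

def daStar (n : ℕ) (σ : Equiv.Perm (Fin n)) : ℕ :=
  ((Finset.Icc 1 n).filter fun i =>
    pext n σ (i - 1) < pext n σ i ∧ pext n σ i < pext n σ (i + 1)).card

def ddStar (n : ℕ) (σ : Equiv.Perm (Fin n)) : ℕ :=
  ((Finset.Icc 1 n).filter fun i =>
    pext n σ (i + 1) < pext n σ i ∧ pext n σ i < pext n σ (i - 1)).card

/-! Linear statistics with the Brändén boundary convention `σ(0)=σ(n+1)=n+1`. -/

def peakB (n : ℕ) (σ : Equiv.Perm (Fin n)) : ℕ :=
  ((Finset.Icc 1 n).filter fun i =>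
    pextB n σ (i - 1) < pextB n σ i ∧ pextB n σ (i + 1) < pextB n σ i).card

def valleyB (n : ℕ) (σ : Equiv.Perm (Fin n)) : ℕ :=
  ((Finset.Icc 1 n).filter fun i =>
    pextB n σ i < pextB n σ (i - 1) ∧ pextB n σ i < pextB n σ (i + 1)).card

def daB (n : ℕ) (σ : Equiv.Perm (Fin n)) : ℕ :=
  ((Finset.Icc 1 n).filter fun i =>
    pextB n σ (i - 1) < pextB n σ i ∧ pextB n σ i < pextB n σ (i + 1)).card

def ddB (n : ℕ) (σ : Equiv.Perm (Fin n)) : ℕ :=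
  ((Finset.Icc 1 n).filter fun i =>
    pextB n σ (i + 1) < pextB n σ i ∧ pextB n σ i < pextB n σ (i - 1)).card

/-! Linear statistics with the boundary convention `σ(0)=0`, `σ(n+1)=n+1`. -/

def valleyC (n : ℕ) (σ : Equiv.Perm (Fin n)) : ℕ :=
  ((Finset.Icc 1 n).filter fun i =>
    pextC n σ i < pextC n σ (i - 1) ∧ pextC n σ i < pextC n σ (i + 1)).card

def daC (n : ℕ) (σ : Equiv.Perm (Fin n)) : ℕ :=
  ((Finset.Icc 1 n).filter fun i =>
    pextC n σ (i - 1) < pextC n σ i ∧ pextC n σ i < pextC n σ (i + 1)).card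

def ddC (n : ℕ) (σ : Equiv.Perm (Fin n)) : ℕ :=
  ((Finset.Icc 1 n).filter fun i =>
    pextC n σ (i + 1) < pextC n σ i ∧ pextC n σ i < pextC n σ (i - 1)).card

/-- `fmax σ`: the number of double ascents (convention `σ(0)=0`, `σ(n+1)=n+1`)
which are left-to-right maxima. -/
def fmaxStat (n : ℕ) (σ : Equiv.Perm (Fin n)) : ℕ :=
  ((Finset.Icc 1 n).filter fun i =>
    pextC n σ (i - 1) < pextC n σ i ∧ pextC n σ i < pextC n σ (i + 1) ∧
    ∀ j ∈ Finset.Ico 1 i, pext n σ j < pext n σ i).card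

/-! Cyclic statistics. -/

def excStat (n : ℕ) (σ : Equiv.Perm (Fin n)) : ℕ :=
  ((Finset.Icc 1 n).filter fun i => i < pext n σ i).card

def wexStat (n : ℕ) (σ : Equiv.Perm (Fin n)) : ℕ :=
  ((Finset.Icc 1 n).filter fun i => i ≤ pext n σ i).card

def dropStat (n : ℕ) (σ : Equiv.Perm (Fin n)) : ℕ :=
  ((Finset.Icc 1 n).filter fun i => pext n σ i < i).card

def fixStat (n : ℕ) (σ : Equiv.Perm (Fin n)) : ℕ :=
  ((Finset.Icc 1 n).filter fun i => pext n σ i = i).card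

/-- cyclic valleys: `x` with `σ⁻¹(x) > x < σ(x)`. -/
def cvalleyStat (n : ℕ) (σ : Equiv.Perm (Fin n)) : ℕ :=
  ((Finset.Icc 1 n).filter fun x => x < pext n σ⁻¹ x ∧ x < pext n σ x).card

/-- double excedances: `x` with `σ⁻¹(x) < x < σ(x)`. -/
def cdaStat (n : ℕ) (σ : Equiv.Perm (Fin n)) : ℕ :=
  ((Finset.Icc 1 n).filter fun x => pext n σ⁻¹ x < x ∧ x < pext n σ x).card

/-- double drops: `x` with `σ⁻¹(x) > x > σ(x)`. -/
def cddStat (n : ℕ) (σ : Equiv.Perm (Fin n)) : ℕ :=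
  ((Finset.Icc 1 n).filter fun x => x < pext n σ⁻¹ x ∧ pext n σ x < x).card

/-- crossings. -/
def crosStat (n : ℕ) (σ : Equiv.Perm (Fin n)) : ℕ :=
  ((pairs n).filter fun x =>
    (x.1 < x.2 ∧ x.2 ≤ pext n σ x.1 ∧ pext n σ x.1 < pext n σ x.2) ∨
    (x.2 < x.1 ∧ pext n σ x.1 < x.2 ∧ pext n σ x.2 < pext n σ x.1)).card

/-- nestings. -/
def nestStat (n : ℕ) (σ : Equiv.Perm (Fin n)) : ℕ :=
  ((pairs n).filter fun x =>
    (x.1 < x.2 ∧ x.2 ≤ pext n σ x.2 ∧ pext n σ x.2 < pext n σ x.1) ∨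
    (x.2 < x.1 ∧ pext n σ x.2 < x.2 ∧ pext n σ x.1 < pext n σ x.2)).card

/-- number of cycles of `σ` (fixed points count as cycles). -/
def cycStat (n : ℕ) (σ : Equiv.Perm (Fin n)) : ℕ :=
  Multiset.card σ.cycleType + (Finset.univ.filter fun x => σ x = x).card

/-! Star statistics: `σ*(i) = σ(i) − 1`, a bijection `[n] → {0,…,n−1}`;
we extend `σ*` by `0` outside `[1,n]`. -/

def starf (n : ℕ) (σ : Equiv.Perm (Fin n)) (i : ℕ) : ℕ :=
  if 1 ≤ i ∧ i ≤ n then pext n σ i - 1 else 0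

/-- `(σ*)⁻¹(i) = σ⁻¹(i+1)`, defined for `0 ≤ i ≤ n−1`. -/
def invstarf (n : ℕ) (σ : Equiv.Perm (Fin n)) (i : ℕ) : ℕ :=
  pext n σ⁻¹ (i + 1)

def dropStarStat (n : ℕ) (σ : Equiv.Perm (Fin n)) : ℕ :=
  ((Finset.Icc 1 n).filter fun i => starf n σ i < i).card

def fixStarStat (n : ℕ) (σ : Equiv.Perm (Fin n)) : ℕ :=
  ((Finset.Icc 1 n).filter fun i => starf n σ i = i).card

def wexStarStat (n : ℕ) (σ : Equiv.Perm (Fin n)) : ℕ :=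
  ((Finset.Icc 1 n).filter fun i => i ≤ starf n σ i).card

def cdaStarStat (n : ℕ) (σ : Equiv.Perm (Fin n)) : ℕ :=
  ((Finset.Icc 1 n).filter fun i => invstarf n σ i < i ∧ i < starf n σ i).card

def cddStarStat (n : ℕ) (σ : Equiv.Perm (Fin n)) : ℕ :=
  ((Finset.Icc 1 n).filter fun i => i < invstarf n σ i ∧ starf n σ i < i).card

def cvalleyStarStat (n : ℕ) (σ : Equiv.Perm (Fin n)) : ℕ :=
  ((Finset.Icc 1 n).filter fun i => i < invstarf n σ i ∧ i < starf n σ i).card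

def crosStarStat (n : ℕ) (σ : Equiv.Perm (Fin n)) : ℕ :=
  ((pairs n).filter fun x =>
    (x.1 < x.2 ∧ x.2 ≤ starf n σ x.1 ∧ starf n σ x.1 < starf n σ x.2) ∨
    (x.2 < x.1 ∧ starf n σ x.1 < x.2 ∧ starf n σ x.2 < starf n σ x.1)).card

def nestStarStat (n : ℕ) (σ : Equiv.Perm (Fin n)) : ℕ :=
  ((pairs n).filter fun x =>
    (x.1 < x.2 ∧ x.2 ≤ starf n σ x.2 ∧ starf n σ x.2 < starf n σ x.1) ∨
    (x.2 < x.1 ∧ starf n σ x.2 < x.2 ∧ starf n σ x.1 < starf n σ x.2)).card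

/-- `cyc* σ`: the number of cycles of the functional digraph of `σ*` on `[n]`,
counted as the number of `i ∈ [1,n]` that lie on a cycle of `σ*` and are
minimal in their cycle. (The component of `σ*` that is a path from `n` to `0`
contributes no such `i`.) -/
def cycStarStat (n : ℕ) (σ : Equiv.Perm (Fin n)) : ℕ :=
  ((Finset.Icc 1 n).filter fun i =>
    (∃ m ∈ Finset.Icc 1 n, (starf n σ)^[m] i = i) ∧
    ∀ m ∈ Finset.range (n + 1), i ≤ (starf n σ)^[m] i).card

/-! Motzkin paths, encoded as step sequences `γ : Fin m → Fin 3`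
(`0` = up step `(1,1)`, `1` = level step `(1,0)`, `2` = down step `(1,−1)`). -/

/-- The height (ordinate) of the path after `i` steps. -/
def hgt (m : ℕ) (γ : Fin m → Fin 3) (i : ℕ) : ℤ :=
  ∑ j ∈ Finset.range i, if hj : j < m then 1 - ((γ ⟨j, hj⟩ : ℕ) : ℤ) else 0

/-- A step sequence is a Motzkin path if it never goes below the x-axis and
ends at height `0`. -/
def IsMotzkin (m : ℕ) (γ : Fin m → Fin 3) : Prop :=
  (∀ i ≤ m, 0 ≤ hgt m γ i) ∧ hgt m γ m = 0

/-- The (finite) set of Motzkin paths of length `m`. -/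
def motzkin (m : ℕ) : Finset (Fin m → Fin 3) :=
  Finset.univ.filter fun γ => IsMotzkin m γ

/-- number of up (North-East) steps. -/
def neCount (m : ℕ) (γ : Fin m → Fin 3) : ℕ :=
  (Finset.univ.filter fun i => γ i = 0).card

/-- number of level (East) steps. -/
def eCount (m : ℕ) (γ : Fin m → Fin 3) : ℕ :=
  (Finset.univ.filter fun i => γ i = 1).card

/-- the `(p,q)`-integer `[m]_{p,q} = p^{m−1} + p^{m−2}q + ⋯ + q^{m−1}`. -/
def pqInt {R : Type*} [CommRing R] (p q : R) (m : ℕ) : R :=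
  ∑ j ∈ Finset.range m, p ^ (m - 1 - j) * q ^ j

open MvPolynomial in
/-- `a_{n,k}(p,q)` (with `p = X 0`, `q = X 1`), as an element of `ℤ[p,q,t,u,v,w]`. -/
def aPoly6 (n k : ℕ) : MvPolynomial (Fin 6) ℤ :=
  ∑ σ ∈ Finset.univ.filter
      (fun σ : Equiv.Perm (Fin n) => valleyStar n σ = k ∧ ddStar n σ = 0),
    X 0 ^ resStat n σ * X 1 ^ lesStat n σ

/-! ### Words -/

/-- The number of `31-2` patterns of a word. -/
def lesWord : List ℕ → ℕ
  | a :: b :: t => t.countP (fun y => b < y ∧ y < a) + lesWord (b :: t)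
  | _ => 0

/-- The product over the letters `y` of a word of `g y (left neighbour < y) (right neighbour < y)`,
where the word is preceded by `a` and followed by `z`. -/
def letterProd {R : Type*} [CommRing R] (g : ℕ → Bool → Bool → R) (z : ℕ) : ℕ → List ℕ → R
  | _, [] => 1
  | a, y :: t => g y (a < y) (t.head?.getD z < y) * letterProd g z y t

section LetterProd

variable {R : Type*} [CommRing R]

lemma letterProd_cons (g : ℕ → Bool → Bool → R) (z a y : ℕ) (t : List ℕ) :
    letterProd g z a (y :: t) =
      g y (a < y) (t.head?.getD z < y) * letterProd g z y t := rfl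

lemma letterProd_append (g : ℕ → Bool → Bool → R) (z a : ℕ) (l m : List ℕ) :
    letterProd g z a (l ++ m) =
      letterProd g (m.head?.getD z) a l * letterProd g z (l.getLast?.getD a) m := by
  induction l generalizing a with
  | nil => simp [letterProd]
  | cons y t ih =>
    have h : (t ++ m).head?.getD z = t.head?.getD (m.head?.getD z) := by cases t <;> simp
    have h' : (y :: t).getLast?.getD a = t.getLast?.getD y := by
      cases t <;> simp [List.getLast?_cons]
    rw [List.cons_append, letterProd, letterProd, ih, h, h', mul_assoc]

lemma letterProd_congr_left (g : ℕ → Bool → Bool → R) (z : ℕ) {a a' : ℕ} {l : List ℕ}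
    (h : ∀ y ∈ l.head?, (a < y ↔ a' < y)) : letterProd g z a l = letterProd g z a' l := by
  cases l with
  | nil => rfl
  | cons y t => simp [letterProd, h y (by simp)]

lemma letterProd_congr_right (g : ℕ → Bool → Bool → R) {z z' : ℕ} (a : ℕ) {l : List ℕ}
    (h : ∀ y ∈ l.getLast?, (z < y ↔ z' < y)) : letterProd g z a l = letterProd g z' a l := by
  induction l generalizing a with
  | nil => rfl
  | cons y t ih =>
    cases t with
    | nil =>
      have : decide (([] : List ℕ).head?.getD z < y) = decide (([] : List ℕ).head?.getD z' < y) :=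
        decide_eq_decide.2 (h y (by simp))
      rw [letterProd_cons, letterProd_cons, this]
      rfl
    | cons b s =>
      rw [letterProd, ih y fun e he => h e (by simpa using he)]
      rfl

lemma letterProd_congr {g g' : ℕ → Bool → Bool → R} (z a : ℕ) {l : List ℕ}
    (h : ∀ y ∈ l, g y = g' y) : letterProd g z a l = letterProd g' z a l := by
  induction l generalizing a with
  | nil => rfl
  | cons y t ih =>
    rw [letterProd, letterProd, ih _ fun e he => h e (List.mem_cons_of_mem _ he),
      h y List.mem_cons_self]

end LetterProd

lemma lesWord_append_congr {u v : List ℕ} (l : List ℕ) (huv : u.Perm v)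
    (hu : ∀ e ∈ l.getLast?, ∀ y ∈ u.head?, e < y) (hv : ∀ e ∈ l.getLast?, ∀ y ∈ v.head?, e < y)
    (h : lesWord u = lesWord v) : lesWord (l ++ u) = lesWord (l ++ v) := by
  induction l with
  | nil => simpa
  | cons a t ih =>
    cases t with
    | nil =>
      have key : ∀ w : List ℕ, (∀ y ∈ w.head?, a < y) → lesWord (a :: w) = lesWord w := by
        intro w hw
        cases w with
        | nil => rfl
        | cons y s =>
          have := hw y (by simp)
          rw [lesWord, Nat.add_eq_right, List.countP_eq_zero]
          simp only [decide_eq_true_eq]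
          omega
      simpa [key u (hu a (by simp)), key v (hv a (by simp))] using h
    | cons b s =>
      have := ih (fun e he => hu e (by simpa using he)) (fun e he => hv e (by simpa using he))
      simp only [List.cons_append, lesWord] at this ⊢
      rw [this, (huv.append_left s).countP_eq]

lemma lesWord_hop_right {x : ℕ} {b c : List ℕ} (hb : ∀ y ∈ b, x < y) (hc : ∀ y ∈ c.head?, y < x)
    (hxc : x ∉ c) : lesWord (x :: (b ++ c)) = lesWord (b ++ x :: c) := by
  have core : ∀ b : List ℕ, b ≠ [] → (∀ y ∈ b, x < y) →
      lesWord (b ++ x :: c) = lesWord (b ++ c) := by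
    intro b hb0 hb
    induction b with
    | nil => exact absurd rfl hb0
    | cons e t ih =>
      have hxe := hb e List.mem_cons_self
      cases t with
      | nil =>
        cases c with
        | nil => simp [lesWord]
        | cons d s =>
          have hdx := hc d (by simp)
          have hs : ∀ y ∈ s, y ≠ x := by rintro y hy rfl; exact hxc (List.mem_cons_of_mem _ hy)
          have hcount : s.countP (fun y => x < y ∧ y < e) + s.countP (fun y => d < y ∧ y < x) =
              s.countP (fun y => d < y ∧ y < e) := by
            clear hxc hc ih
            induction s with
            | nil => rfl
            | cons y s ihs =>
              have := ihs fun y hy => hs y (List.mem_cons_of_mem _ hy)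
              have := hs y List.mem_cons_self
              simp only [List.countP_cons, decide_eq_true_eq]
              split_ifs <;> omega
          simp only [List.cons_append, List.nil_append, lesWord, List.countP_cons,
            decide_eq_true_eq]
          rw [if_neg (by omega)]
          omega
      | cons f s =>
        have := ih (by simp) fun y hy => hb y (List.mem_cons_of_mem _ hy)
        have hxf := hb f (by simp)
        simp only [List.cons_append, lesWord] at this ⊢
        rw [this]
        simp only [List.countP_append, List.countP_cons, decide_eq_true_eq]
        rw [if_neg (by omega)]
        omega
  cases b with
  | nil => rfl
  | cons e t =>
    have := hb e List.mem_cons_self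
    rw [core _ (by simp) hb, List.cons_append, lesWord, Nat.add_eq_right, List.countP_eq_zero]
    simp only [decide_eq_true_eq]
    omega

lemma lesWord_hop {x : ℕ} {a b c : List ℕ} (ha : ∀ y ∈ a.getLast?, y < x) (hb : ∀ y ∈ b, x < y)
    (hc : ∀ y ∈ c.head?, y < x) (hxc : x ∉ c) :
    lesWord (a ++ x :: (b ++ c)) = lesWord (a ++ (b ++ x :: c)) := by
  rcases eq_or_ne b [] with rfl | hb0
  · rfl
  refine lesWord_append_congr a List.perm_middle.symm ?_ ?_ (lesWord_hop_right hb hc hxc)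
  · intro e he y hy
    obtain rfl : x = y := by simpa using hy
    exact ha e he
  · intro e he y hy
    obtain ⟨d, t, rfl⟩ := List.exists_cons_of_ne_nil hb0
    obtain rfl : d = y := by simpa using hy
    exact (ha e he).trans (hb d (by simp))

/-- The two maximal blocks of letters larger than `x` adjacent to `x` are exchanged
if one of them is empty. -/
def hop (x : ℕ) (l : List ℕ) : List ℕ :=
  if x ∈ l then
    let m := l.takeWhile (· ≠ x)
    let r := (l.dropWhile (· ≠ x)).tail
    let b := m.rtakeWhile (x < ·)
    let d := r.takeWhile (x < ·)
    if b = [] ∨ d = [] then m.rdropWhile (x < ·) ++ (d ++ x :: (b ++ r.dropWhile (x < ·))) else l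
  else l

/-- `a, b, d, c` are the parts of a word `a b x d c` such that `b` and `d` are the maximal blocks
of letters larger than `x` adjacent to `x`. -/
structure IsSplit (x : ℕ) (a b d c : List ℕ) : Prop where
  left : ∀ y ∈ a.getLast?, y < x
  right : ∀ y ∈ c.head?, y < x
  block_left : ∀ y ∈ b, x < y
  block_right : ∀ y ∈ d, x < y
  not_mem_left : x ∉ a
  not_mem_right : x ∉ c

lemma IsSplit.swap {x : ℕ} {a b d c : List ℕ} (h : IsSplit x a b d c) : IsSplit x a d b c :=
  ⟨h.left, h.right, h.block_right, h.block_left, h.not_mem_left, h.not_mem_right⟩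

lemma IsSplit.getLast_lt {x : ℕ} {a b d c : List ℕ} (h : IsSplit x a b d c) (hx : 0 < x) :
    a.getLast?.getD 0 < x := by
  rcases hl : a.getLast? with _ | y
  · simpa
  · simpa using h.left y (by simp [hl])

lemma IsSplit.head_lt {x : ℕ} {a b d c : List ℕ} (h : IsSplit x a b d c) (hx : 0 < x) :
    c.head?.getD 0 < x := by
  rcases hl : c.head? with _ | y
  · simpa
  · simpa using h.right y (by simp [hl])

lemma IsSplit.hop_eq {x : ℕ} {a b d c : List ℕ} (h : IsSplit x a b d c) :
    hop x (a ++ (b ++ x :: (d ++ c))) =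
      if b = [] ∨ d = [] then a ++ (d ++ x :: (b ++ c)) else a ++ (b ++ x :: (d ++ c)) := by
  have hne : ∀ y ∈ a ++ b, decide (y ≠ x) = true := by
    intro y hy
    rcases List.mem_append.1 hy with hy | hy
    · simpa using fun e : y = x => h.not_mem_left (e ▸ hy)
    · simpa using (h.block_left y hy).ne'
  have h1 : (a ++ (b ++ x :: (d ++ c))).takeWhile (· ≠ x) = a ++ b := by
    rw [← List.append_assoc, List.takeWhile_append_of_pos hne]
    simp
  have h2 : (a ++ (b ++ x :: (d ++ c))).dropWhile (· ≠ x) = x :: (d ++ c) := by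
    rw [← List.append_assoc, List.dropWhile_append_of_pos hne]
    simp
  have hd : ∀ y ∈ d, decide (x < y) = true := by simpa using h.block_right
  have hb : ∀ y ∈ b.reverse, decide (x < y) = true := by simpa using h.block_left
  have h3 : (d ++ c).takeWhile (x < ·) = d := by
    rw [List.takeWhile_append_of_pos hd]
    rcases c with _ | ⟨y, t⟩
    · simp
    · simp [(h.right y (by simp)).le]
  have h4 : (d ++ c).dropWhile (x < ·) = c := by
    rw [List.dropWhile_append_of_pos hd]
    rcases c with _ | ⟨y, t⟩
    · simp
    · simp [(h.right y (by simp)).le]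
  have ha : ∀ y ∈ a.reverse.head?, y < x := by simpa using h.left
  have h5 : (a ++ b).rtakeWhile (x < ·) = b := by
    rw [List.rtakeWhile, List.reverse_append, List.takeWhile_append_of_pos hb]
    rcases hr : a.reverse with _ | ⟨y, t⟩
    · simp
    · simp [(ha y (by simp [hr])).le]
  have h6 : (a ++ b).rdropWhile (x < ·) = a := by
    rw [List.rdropWhile, List.reverse_append, List.dropWhile_append_of_pos hb, List.reverse_eq_iff]
    rcases hr : a.reverse with _ | ⟨y, t⟩
    · simp
    · simp [(ha y (by simp [hr])).le]
  rw [hop, if_pos (by simp)]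
  simp only [h1, h2, List.tail_cons, h3, h4, h5, h6]

lemma exists_isSplit {x : ℕ} {l : List ℕ} (hl : l.Nodup) (hx : x ∈ l) :
    ∃ a b d c, l = a ++ (b ++ x :: (d ++ c)) ∧ IsSplit x a b d c := by
  obtain ⟨m, r, rfl⟩ := List.append_of_mem hx
  have hxm : x ∉ m := fun h => (List.disjoint_of_nodup_append hl) h List.mem_cons_self
  have hxr : x ∉ r := (List.nodup_cons.1 hl.of_append_right).1
  refine ⟨m.rdropWhile (x < ·), m.rtakeWhile (x < ·), r.takeWhile (x < ·), r.dropWhile (x < ·),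
    ?_, ?_, ?_, ?_, ?_, ?_, ?_⟩
  · rw [List.takeWhile_append_dropWhile, ← List.append_assoc, List.rdropWhile_append_rtakeWhile]
  · intro y hy
    have hm := List.mem_of_getLast? hy
    have hne : m.rdropWhile (x < ·) ≠ [] := List.ne_nil_of_mem hm
    have := List.rdropWhile_last_not (fun y => decide (x < y)) m hne
    rw [List.getLast?_eq_getLast_of_ne_nil hne] at hy
    obtain rfl := Option.some.inj hy
    have hm' : _ ∈ m := (List.rdropWhile_prefix _ _).subset hm
    have hyx := ne_of_mem_of_not_mem hm' hxm
    simp only [decide_eq_true_eq] at this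
    omega
  · intro y hy
    have := List.head?_dropWhile_not (fun y => decide (x < y)) r
    rw [Option.mem_def.1 hy] at this
    have hm' : y ∈ r := (List.dropWhile_suffix _).subset (List.mem_of_head? hy)
    have hyx := ne_of_mem_of_not_mem hm' hxr
    simp at this
    omega
  · intro y hy
    simpa using List.mem_rtakeWhile_imp hy
  · intro y hy
    simpa using List.mem_takeWhile_imp hy
  · exact fun h => hxm ((List.rdropWhile_prefix _ _).subset h)
  · exact fun h => hxr ((List.dropWhile_suffix _).subset h)

lemma hop_perm {l : List ℕ} (hl : l.Nodup) (x : ℕ) : (hop x l).Perm l := by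
  by_cases hx : x ∈ l
  · obtain ⟨a, b, d, c, rfl, h⟩ := exists_isSplit hl hx
    rw [h.hop_eq]
    split_ifs with hbd
    · refine List.Perm.append_left a ?_
      rcases hbd with rfl | rfl
      · exact List.perm_middle
      · exact List.perm_middle.symm
    · exact List.Perm.refl _
  · rw [hop, if_neg hx]

lemma hop_hop {l : List ℕ} (hl : l.Nodup) (x : ℕ) : hop x (hop x l) = l := by
  by_cases hx : x ∈ l
  · obtain ⟨a, b, d, c, rfl, h⟩ := exists_isSplit hl hx
    rw [h.hop_eq]
    split_ifs with hbd
    · rw [h.swap.hop_eq, if_pos hbd.symm]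
    · rw [h.hop_eq, if_neg hbd]
  · simp [hop, hx]

section WordWeight

variable {R : Type*} [CommRing R]

/-- The weight of a word: `p` counts `2-13`, `q` counts `31-2`, `g` weighs the letters. -/
def wordWeight (p q : R) (g : ℕ → Bool → Bool → R) (l : List ℕ) : R :=
  p ^ lesWord l.reverse * q ^ lesWord l * letterProd g 0 0 l

lemma letterProd_da (g : ℕ → Bool → Bool → R) {x : ℕ} {a d c : List ℕ}
    (h : IsSplit x a [] d c) (hx : 0 < x) (hd : d ≠ []) :
    letterProd g 0 0 (a ++ x :: (d ++ c)) =
      letterProd g x 0 a * letterProd g x x d * letterProd g 0 (d.getLast?.getD 0) c *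
        g x true false := by
  obtain ⟨e, t, rfl⟩ := List.exists_cons_of_ne_nil hd
  have hax := h.getLast_lt hx
  have hxe := h.block_right e (by simp)
  rw [letterProd_append, letterProd, letterProd_append]
  rw [letterProd_congr_right g (z := c.head?.getD 0) (z' := x) x (l := e :: t)]
  · have hl : (e :: t).getLast?.getD x = (e :: t).getLast?.getD 0 := by simp [List.getLast?_cons]
    have hh : ((e :: t) ++ c).head?.getD 0 = e := rfl
    rw [hl, hh, decide_eq_true hax, decide_eq_false hxe.not_gt]
    simp only [List.cons_append, List.head?_cons, Option.getD_some]
    ring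
  · intro y hy
    have hxy := h.block_right y (List.mem_of_getLast? hy)
    have hcx := h.head_lt hx
    omega

lemma letterProd_dd (g : ℕ → Bool → Bool → R) {x : ℕ} {a d c : List ℕ}
    (h : IsSplit x a [] d c) (hx : 0 < x) (hd : d ≠ []) :
    letterProd g 0 0 (a ++ (d ++ x :: c)) =
      letterProd g x 0 a * letterProd g x x d * letterProd g 0 (d.getLast?.getD 0) c *
        g x false true := by
  obtain ⟨e, t, rfl⟩ := List.exists_cons_of_ne_nil hd
  have hax := h.getLast_lt hx
  have hcx := h.head_lt hx
  have hxe := h.block_right e (by simp)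
  rw [letterProd_append, letterProd_append]
  rw [letterProd_congr_left g _ (a := a.getLast?.getD 0) (a' := x) (l := e :: t),
    letterProd_congr_left g 0 (a := (e :: t).getLast?.getD 0) (a' := x) (l := c),
    letterProd_congr_right g (z := ((e :: t) ++ x :: c).head?.getD 0) (z' := x) 0 (l := a)]
  · have hl : (e :: t).getLast?.getD (a.getLast?.getD 0) = (e :: t).getLast?.getD 0 := by
      simp [List.getLast?_cons]
    have hle : x < (e :: t).getLast?.getD 0 := by
      rw [List.getLast?_eq_getLast_of_ne_nil (by simp)]
      exact h.block_right _ (List.getLast_mem _)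
    rw [hl, letterProd_cons g 0 _ x c, decide_eq_false hle.not_gt, decide_eq_true hcx]
    simp only [List.head?_cons, Option.getD_some]
    ring
  · intro y hy
    have := h.left y hy
    simp
    omega
  · intro y hy
    have := h.right y hy
    have hle : x < (e :: t).getLast?.getD 0 := by
      rw [List.getLast?_eq_getLast_of_ne_nil (by simp)]
      exact h.block_right _ (List.getLast_mem _)
    omega
  · intro y hy
    obtain rfl : e = y := by simpa using hy
    omega

lemma wordWeight_da_add_dd (p q : R) {g g' : ℕ → Bool → Bool → R} {x : ℕ} {a d c : List ℕ}
    (h : IsSplit x a [] d c) (hx : 0 < x) (hd : d ≠ [])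
    (hg : ∀ y ≠ x, g y = g' y)
    (hsum : g x true false + g x false true = g' x true false + g' x false true) :
    wordWeight p q g (a ++ x :: (d ++ c)) + wordWeight p q g (a ++ (d ++ x :: c)) =
      wordWeight p q g' (a ++ x :: (d ++ c)) + wordWeight p q g' (a ++ (d ++ x :: c)) := by
  have hles := lesWord_hop h.left h.block_right h.right h.not_mem_right
  have hres : lesWord (a ++ x :: (d ++ c)).reverse = lesWord (a ++ (d ++ x :: c)).reverse := by
    have := lesWord_hop (x := x) (a := c.reverse) (b := d.reverse) (c := a.reverse)
      (by simpa using h.right) (by simpa using h.block_right) (by simpa using h.left)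
      (by simpa using h.not_mem_left)
    simpa using this.symm
  have hxd : x ∉ d := fun hm => lt_irrefl _ (h.block_right x hm)
  have e1 : letterProd g x 0 a = letterProd g' x 0 a :=
    letterProd_congr _ _ fun y hy => hg y (ne_of_mem_of_not_mem hy h.not_mem_left)
  have e2 : letterProd g x x d = letterProd g' x x d :=
    letterProd_congr _ _ fun y hy => hg y (ne_of_mem_of_not_mem hy hxd)
  have e3 : letterProd g 0 (d.getLast?.getD 0) c = letterProd g' 0 (d.getLast?.getD 0) c :=
    letterProd_congr _ _ fun y hy => hg y (ne_of_mem_of_not_mem hy h.not_mem_right)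
  simp only [wordWeight, letterProd_da _ h hx hd, letterProd_dd _ h hx hd, hles, hres, e1, e2, e3]
  linear_combination p ^ lesWord (a ++ (d ++ x :: c)).reverse * q ^ lesWord (a ++ (d ++ x :: c)) *
    (letterProd g' x 0 a * letterProd g' x x d * letterProd g' 0 (d.getLast?.getD 0) c) * hsum

lemma letterProd_split_congr {g g' : ℕ → Bool → Bool → R} {x : ℕ} {a b d c : List ℕ}
    (h : IsSplit x a b d c) (hx : 0 < x) (hbd : b = [] ↔ d = []) (hg : ∀ y ≠ x, g y = g' y)
    (htt : g x true true = g' x true true) (hff : g x false false = g' x false false) :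
    letterProd g 0 0 (a ++ (b ++ x :: (d ++ c))) =
      letterProd g' 0 0 (a ++ (b ++ x :: (d ++ c))) := by
  have hxb : x ∉ b := fun hm => lt_irrefl _ (h.block_left x hm)
  have hxd : x ∉ d := fun hm => lt_irrefl _ (h.block_right x hm)
  have e : ∀ (z s : ℕ) (l : List ℕ), x ∉ l → letterProd g z s l = letterProd g' z s l :=
    fun z s l hl => letterProd_congr _ _ fun y hy => hg y (ne_of_mem_of_not_mem hy hl)
  simp only [letterProd_append, letterProd, e _ _ a h.not_mem_left, e _ _ b hxb, e _ _ d hxd,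
    e _ _ c h.not_mem_right]
  congr 3
  rcases eq_or_ne b [] with rfl | hb
  · obtain rfl := hbd.1 rfl
    have hax := h.getLast_lt hx
    have hcx := h.head_lt hx
    simpa [hax, hcx] using htt
  · have hd : d ≠ [] := fun hd => hb (hbd.2 hd)
    obtain ⟨e, t, rfl⟩ := List.exists_cons_of_ne_nil hd
    have hxe := h.block_right e (by simp)
    have hle := h.block_left _ (List.getLast_mem hb)
    rw [List.getLast?_eq_getLast_of_ne_nil hb]
    simpa [hxe.not_gt, hle.not_gt] using hff

lemma wordWeight_add_hop (p q : R) {g g' : ℕ → Bool → Bool → R} {x : ℕ} {l : List ℕ}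
    (hl : l.Nodup) (hx : 0 < x) (hg : ∀ y ≠ x, g y = g' y)
    (htt : g x true true = g' x true true) (hff : g x false false = g' x false false)
    (hsum : g x true false + g x false true = g' x true false + g' x false true) :
    wordWeight p q g l + wordWeight p q g (hop x l) =
      wordWeight p q g' l + wordWeight p q g' (hop x l) := by
  by_cases hxl : x ∈ l
  · obtain ⟨a, b, d, c, rfl, h⟩ := exists_isSplit hl hxl
    rw [h.hop_eq]
    rcases eq_or_ne b [] with rfl | hb <;> rcases eq_or_ne d [] with rfl | hd
    · simp only [wordWeight, true_or, if_true, letterProd_split_congr h hx Iff.rfl hg htt hff]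
    · simpa using wordWeight_da_add_dd p q h hx hd hg hsum
    · have := wordWeight_da_add_dd p q h.swap hx hb hg hsum
      simpa [add_comm] using this
    · simp only [wordWeight, hb, hd, or_self, if_false,
        letterProd_split_congr h hx (iff_of_false hb hd) hg htt hff]
  · rw [hop, if_neg hxl]
    simp only [wordWeight,
      letterProd_congr 0 0 fun y hy => hg y (ne_of_mem_of_not_mem hy hxl)]

end WordWeight

/-! ### Words of functions and permutations -/

/-- The word `f 1, …, f n`. -/
def word (n : ℕ) (f : ℕ → ℕ) : List ℕ := List.ofFn fun i : Fin n => f (i + 1)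

lemma word_succ (n : ℕ) (f : ℕ → ℕ) : word (n + 1) f = f 1 :: word n fun i => f (i + 1) := by
  simp [word, List.ofFn_succ]

lemma word_reverse (n : ℕ) (f : ℕ → ℕ) : (word n f).reverse = word n fun i => f (n + 1 - i) := by
  apply List.ext_getElem
  · simp [word]
  · intro i h _
    simp only [word, List.length_reverse, List.length_ofFn] at h
    simp only [word, List.getElem_reverse, List.getElem_ofFn, List.length_ofFn]
    congr 1
    omega

lemma letterProd_word {R : Type*} [CommRing R] (g : ℕ → Bool → Bool → R) (n : ℕ) (f : ℕ → ℕ) :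
    letterProd g (f (n + 1)) (f 0) (word n f) =
      ∏ i ∈ range n, g (f (i + 1)) (f i < f (i + 1)) (f (i + 2) < f (i + 1)) := by
  induction n generalizing f with
  | zero => rfl
  | succ n ih =>
    have hhead : (word n fun i => f (i + 1)).head?.getD (f (n + 1 + 1)) = f 2 := by
      cases n with
      | zero => rfl
      | succ n => rw [word_succ]; rfl
    rw [word_succ, letterProd_cons, hhead, prod_range_succ', mul_comm]
    exact congrArg (· * _) (ih fun i => f (i + 1))

lemma countP_word (P : ℕ → Prop) [DecidablePred P] (n : ℕ) (f : ℕ → ℕ) :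
    (word n f).countP (fun y => P y) = ∑ i ∈ range n, if P (f (i + 1)) then 1 else 0 := by
  induction n generalizing f with
  | zero => rfl
  | succ n ih =>
    rw [word_succ, List.countP_cons, ih, sum_range_succ']
    simp

lemma lesWord_word (n : ℕ) (f : ℕ → ℕ) :
    lesWord (word n f) = ∑ i ∈ range n, ∑ j ∈ range n,
      if 2 ≤ i + 1 ∧ i + 1 < j + 1 ∧ f (i + 1) < f (j + 1) ∧ f (j + 1) < f i then 1 else 0 := by
  induction n generalizing f with
  | zero => rfl
  | succ n ih =>
    cases n with
    | zero => simp [word, lesWord]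
    | succ n =>
      have ih' := ih fun i => f (i + 1)
      rw [word_succ] at ih'
      rw [word_succ, word_succ, lesWord, ih', countP_word, sum_range_succ' _ n]
      conv_rhs => rw [sum_range_succ', sum_range_succ']
      have hstep : ∀ i, (∑ j ∈ range (n + 1 + 1), if 2 ≤ i + 1 + 1 + 1 ∧ i + 1 + 1 + 1 < j + 1 ∧
          f (i + 1 + 1 + 1) < f (j + 1) ∧ f (j + 1) < f (i + 1 + 1) then 1 else 0) =
          ∑ j ∈ range (n + 1), if 2 ≤ i + 1 + 1 ∧ i + 1 + 1 < j + 1 ∧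
          f (i + 1 + 1 + 1) < f (j + 1 + 1) ∧ f (j + 1 + 1) < f (i + 1 + 1) then 1 else 0 := by
        intro i
        rw [sum_range_succ', if_neg (by omega), add_zero]
        refine sum_congr rfl fun j _ => if_congr ?_ rfl rfl
        omega
      simp only [hstep, sum_range_succ' _ n, sum_range_succ' _ (n + 1)]
      rw [add_comm]
      simp

lemma card_filter_Icc (P : ℕ → Prop) [DecidablePred P] (n : ℕ) :
    ((Icc 1 n).filter P).card = ∑ i ∈ range n, if P (i + 1) then 1 else 0 := by
  rw [card_filter, range_eq_Ico, sum_Ico_add' (fun i => if P i then 1 else 0)]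
  rfl

lemma lesStat_eq (n : ℕ) (σ : Equiv.Perm (Fin n)) :
    lesStat n σ = lesWord (word n (pext n σ)) := by
  have h : ∀ F : ℕ → ℕ, ∑ i ∈ Icc 1 n, F i = ∑ i ∈ range n, F (i + 1) := fun F => by
    rw [range_eq_Ico, sum_Ico_add' F]
    rfl
  rw [lesStat, card_filter, pairs, sum_product, lesWord_word, h]
  simp only [h, Nat.add_sub_cancel]

lemma resStat_eq (n : ℕ) (σ : Equiv.Perm (Fin n)) :
    resStat n σ = lesWord (word n (pext n σ)).reverse := by
  have h : ∀ F : ℕ → ℕ, ∑ i ∈ Icc 1 n, F i = ∑ i ∈ range n, F (n - i) := fun F =>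
    sum_nbij' (n - ·) (n - ·) (by simp; omega) (by simp; omega) (by simp; omega)
      (by simp; omega) fun i hi => by rw [Nat.sub_sub_self (mem_Icc.1 hi).2]
  rw [resStat, card_filter, pairs, sum_product, word_reverse, lesWord_word, sum_comm]
  simp only [h]
  refine sum_congr rfl fun i hi => sum_congr rfl fun j hj => if_congr ?_ rfl rfl
  have hi' := mem_range.1 hi
  have hj' := mem_range.1 hj
  rw [Nat.add_sub_add_right, Nat.add_sub_add_right, show n + 1 - i = n - i + 1 by omega]
  omega

/-- The words of the permutations of `[n]`. -/
def words (n : ℕ) : Finset (List ℕ) := univ.image fun σ : Equiv.Perm (Fin n) => word n (pext n σ)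

lemma pext_succ {n : ℕ} (σ : Equiv.Perm (Fin n)) (i : Fin n) : pext n σ (i + 1) = σ i + 1 := by
  rw [pext, dif_pos ⟨by omega, by omega⟩]
  rfl

lemma word_pext (n : ℕ) (σ : Equiv.Perm (Fin n)) :
    word n (pext n σ) = List.ofFn fun i => (σ i : ℕ) + 1 := by
  simp only [word, pext_succ]

lemma mem_words {n : ℕ} {l : List ℕ} :
    l ∈ words n ↔ l.length = n ∧ l.Nodup ∧ ∀ y ∈ l, 1 ≤ y ∧ y ≤ n := by
  simp only [words, mem_image, mem_univ, true_and, word_pext]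
  constructor
  · rintro ⟨σ, rfl⟩
    refine ⟨List.length_ofFn, List.nodup_ofFn.2 fun i j h => ?_, fun y hy => ?_⟩
    · exact σ.injective (Fin.ext (Nat.succ_injective h))
    · obtain ⟨i, rfl⟩ := (List.mem_ofFn' _ _).1 hy
      exact ⟨Nat.succ_pos _, (σ i).isLt⟩
  · rintro ⟨rfl, hl, hy⟩
    have hb : ∀ i : Fin l.length, 1 ≤ l.get i ∧ l.get i ≤ l.length := fun i => hy _ (l.get_mem i)
    let s : Fin l.length → Fin l.length := fun i => ⟨l.get i - 1, by have := hb i; omega⟩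
    have hs : Function.Injective s := fun i j h => by
      have := congrArg Fin.val h
      have := hb i
      have := hb j
      exact hl.injective_get (by simp only [s] at *; omega)
    refine ⟨Equiv.ofBijective s (Finite.injective_iff_bijective.1 hs), ?_⟩
    conv_rhs => rw [← List.ofFn_get l]
    congr 1
    funext i
    have := hb i
    simp only [Equiv.ofBijective_apply, s]
    omega

lemma sum_words {M : Type*} [AddCommMonoid M] (n : ℕ) (F : List ℕ → M) :
    ∑ l ∈ words n, F l = ∑ σ : Equiv.Perm (Fin n), F (word n (pext n σ)) := by
  refine sum_image fun σ _ τ _ h => ?_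
  simp only [word_pext] at h
  ext i
  exact Nat.succ_injective (congrFun (List.ofFn_injective h) i)

lemma hop_mem_words {n : ℕ} {l : List ℕ} (hl : l ∈ words n) (x : ℕ) : hop x l ∈ words n := by
  rw [mem_words] at hl ⊢
  have hp := hop_perm hl.2.1 x
  exact ⟨hp.length_eq.trans hl.1, hp.nodup_iff.2 hl.2.1, fun y hy => hl.2.2 y (hp.mem_iff.1 hy)⟩

section Weights

variable {R : Type*} [CommRing R]

/-- The weight of a letter by its type: `u` for double ascents, `v` for double descents,
`w` for valleys. -/
def letterWeight (u v w : R) : Bool → Bool → R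
  | true, false => u
  | false, true => v
  | false, false => w
  | true, true => 1

lemma sum_wordWeight_congr [NoZeroDivisors R] [CharZero R] (n : ℕ) (p q : R)
    {g g' : ℕ → Bool → Bool → R} {x : ℕ} (hx : 0 < x) (hg : ∀ y ≠ x, g y = g' y)
    (htt : g x true true = g' x true true) (hff : g x false false = g' x false false)
    (hsum : g x true false + g x false true = g' x true false + g' x false true) :
    ∑ l ∈ words n, wordWeight p q g l = ∑ l ∈ words n, wordWeight p q g' l := by
  have hhop : ∀ F : List ℕ → R, ∑ l ∈ words n, F (hop x l) = ∑ l ∈ words n, F l := fun F =>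
    sum_nbij' (hop x) (hop x) (fun l hl => hop_mem_words hl x) (fun l hl => hop_mem_words hl x)
      (fun l hl => hop_hop (mem_words.1 hl).2.1 x) (fun l hl => hop_hop (mem_words.1 hl).2.1 x)
      fun _ _ => rfl
  have h := sum_congr (rfl : words n = words n) fun l hl =>
    wordWeight_add_hop p q (mem_words.1 hl).2.1 hx hg htt hff hsum
  rw [sum_add_distrib, sum_add_distrib, hhop, hhop, ← two_mul, ← two_mul] at h
  exact mul_left_cancel₀ two_ne_zero h

lemma sum_wordWeight_letterWeight [NoZeroDivisors R] [CharZero R] (n : ℕ) (p q u v w : R) :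
    ∑ l ∈ words n, wordWeight p q (fun _ => letterWeight u v w) l =
      ∑ l ∈ words n, wordWeight p q (fun _ => letterWeight (u + v) 0 w) l := by
  have key : ∀ T : Finset ℕ, (∀ x ∈ T, 0 < x) →
      ∑ l ∈ words n, wordWeight p q (fun _ => letterWeight u v w) l =
        ∑ l ∈ words n, wordWeight p q
          (fun y => if y ∈ T then letterWeight (u + v) 0 w else letterWeight u v w) l := by
    intro T
    induction T using Finset.induction_on with
    | empty => simp
    | insert x T hxT ih =>
      intro hT
      rw [ih fun y hy => hT y (mem_insert_of_mem hy)]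
      refine sum_wordWeight_congr n p q (hT x (mem_insert_self x T)) (fun y hy => ?_) ?_ ?_ ?_
      · simp [hy]
      all_goals simp [hxT, letterWeight]
  rw [key (Icc 1 n) fun x hx => (mem_Icc.1 hx).1]
  refine sum_congr rfl fun l hl => ?_
  rw [wordWeight, wordWeight, letterProd_congr 0 0 fun y hy => ?_]
  rw [if_pos (mem_Icc.2 ((mem_words.1 hl).2.2 y hy))]

end Weights

section Perm

variable {n : ℕ} (σ : Equiv.Perm (Fin n))

lemma pext_zero : pext n σ 0 = 0 := by simp [pext]

lemma pext_last : pext n σ (n + 1) = 0 := by simp [pext]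

lemma pext_pos {i : ℕ} (h : 1 ≤ i) (h' : i ≤ n) : 0 < pext n σ i := by
  rw [pext, dif_pos ⟨h, h'⟩]
  omega

lemma pext_ne_succ (hn : 1 ≤ n) {i : ℕ} (hi : i ≤ n) : pext n σ i ≠ pext n σ (i + 1) := by
  rcases Nat.eq_zero_or_pos i with rfl | h0
  · exact (pext_zero σ).trans_ne (pext_pos σ le_rfl hn).ne
  rcases hi.eq_or_lt with rfl | hlt
  · exact ((pext_last σ).trans_ne (pext_pos σ h0 le_rfl).ne).symm
  · rw [pext, pext, dif_pos ⟨h0, hi⟩, dif_pos ⟨by omega, hlt⟩]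
    intro h
    have := congrArg Fin.val (σ.injective (Fin.ext (Nat.succ_injective h)))
    simp at this
    omega

lemma desStat_eq (hn : 1 ≤ n) : desStat n σ = ddStar n σ + valleyStar n σ := by
  obtain ⟨m, rfl⟩ : ∃ m, n = m + 1 := ⟨n - 1, by omega⟩
  have h0 : ¬ pext (m + 1) σ (0 + 1) < pext (m + 1) σ 0 := by simp [pext_zero]
  have h : desStat (m + 1) σ =
      ∑ i ∈ range (m + 1), if pext (m + 1) σ (i + 1) < pext (m + 1) σ i then 1 else 0 := by
    rw [desStat, card_filter_Icc, sum_range_succ', if_neg h0, Nat.add_sub_cancel, add_zero]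
  rw [h, ddStar, valleyStar, card_filter_Icc, card_filter_Icc, ← sum_add_distrib]
  refine sum_congr rfl fun i hi => ?_
  have := pext_ne_succ σ hn (i := i + 1) (by simpa using hi)
  simp only [Nat.add_sub_cancel]
  split_ifs <;> omega

lemma daStar_add_ddStar (hn : 1 ≤ n) :
    daStar n σ + ddStar n σ + 2 * valleyStar n σ + 1 = n := by
  let a : ℕ → ℤ := fun i => if pext n σ i < pext n σ (i + 1) then 1 else 0
  have h1 : a 0 - a n = 1 := by
    simp [a, pext_zero, pext_last, pext_pos σ le_rfl hn]
  have h2 : ∑ i ∈ range n, (1 : ℤ) = n := by simp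
  rw [← sum_range_sub' a n] at h1
  zify
  rw [← h1]
  conv_rhs => rw [← h2]
  simp only [daStar, ddStar, valleyStar, card_filter_Icc, Nat.cast_sum, mul_sum,
    ← sum_add_distrib]
  refine sum_congr rfl fun i hi => ?_
  have hi' := mem_range.1 hi
  have := pext_ne_succ σ hn (i := i) (by omega)
  have := pext_ne_succ σ hn (i := i + 1) (by omega)
  simp only [a, Nat.add_sub_cancel]
  push_cast
  split_ifs <;> omega

lemma wordWeight_word {R : Type*} [CommRing R] (hn : 1 ≤ n) (p q u v w : R) :
    wordWeight p q (fun _ => letterWeight u v w) (word n (pext n σ)) =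
      p ^ resStat n σ * q ^ lesStat n σ *
        (u ^ daStar n σ * v ^ ddStar n σ * w ^ valleyStar n σ) := by
  have h := letterProd_word (fun _ => letterWeight u v w) n (pext n σ)
  rw [pext_zero, pext_last] at h
  rw [wordWeight, ← lesStat_eq, ← resStat_eq, h, daStar, ddStar, valleyStar]
  simp only [card_filter_Icc, ← prod_pow_eq_pow_sum, ← prod_mul_distrib]
  congr 1
  refine prod_congr rfl fun i hi => ?_
  have hi' := mem_range.1 hi
  have h1 := pext_ne_succ σ hn (i := i) (by omega)
  have h2 := pext_ne_succ σ hn (i := i + 1) (by omega)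
  simp only [Nat.add_sub_cancel]
  rcases h1.lt_or_gt with h1 | h1 <;> rcases h2.lt_or_gt with h2 | h2 <;>
    simp [h1, h2, h1.not_gt, h2.not_gt, letterWeight]

end Perm

open MvPolynomial in
theorem statement0 (n : ℕ) (hn : 1 ≤ n) :
    (∑ σ : Equiv.Perm (Fin n),
        (X 0 : MvPolynomial (Fin 6) ℤ) ^ resStat n σ * X 1 ^ lesStat n σ *
          X 2 ^ desStat n σ * X 3 ^ daStar n σ * X 4 ^ ddStar n σ *
          X 5 ^ valleyStar n σ) =
      ∑ k ∈ Finset.range ((n - 1) / 2 + 1),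
        aPoly6 n k * (X 2 * X 5) ^ k * (X 3 + X 4 * X 2) ^ (n - 1 - 2 * k) := by
  have h := sum_wordWeight_letterWeight n (X 0 : MvPolynomial (Fin 6) ℤ) (X 1) (X 3) (X 4 * X 2)
    (X 2 * X 5)
  simp only [sum_words, wordWeight_word _ hn] at h
  calc _ = _ := sum_congr rfl fun σ _ => by rw [desStat_eq σ hn]; ring
    _ = _ := h
    _ = _ := by
      simp only [aPoly6, sum_mul, sum_filter, ite_mul, zero_mul]
      rw [sum_comm]
      refine sum_congr rfl fun σ _ => ?_
      have hcount := daStar_add_ddStar σ hn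
      by_cases hdd : ddStar n σ = 0
      · simp only [hdd, and_true, sum_ite_eq]
        rw [if_pos (mem_range.2 (by omega)),
          show n - 1 - 2 * valleyStar n σ = daStar n σ by omega]
        ring
      · simp [hdd]

end SZpaper
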